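/- arXiv:1304.3836 — 3 statements merged into one kernel-verified Lean document; each statement's English description precedes it below -/
import Mathlib

section
/- Every Lie algebra automorphism σ of D_n = Der_K(P_n) with σ(∂_i) = ∂_i for all i = 1,...,n is induced by conjugation by a shift automorphism of P_n: there exist λ_1,...,λ_n ∈ K such that σ(δ) = s_λ δ s_λ^{-1} for all δ ∈ D_n, where s_λ(x_i) = x_i + λ_i. -/
open MvPolynomial

theorem aux_lie_sub {K A : Type*} [Field K] [CommRing A] [Algebra K A] (a b c : Derivation K A A) :
    ⁅a, b - c⁆ = ⁅a, b⁆ - ⁅a, c⁆ := by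
  ext x
  simp only [Derivation.commutator_apply, Derivation.sub_apply, map_sub]
  ring

/-- A polynomial all of whose partial derivatives vanish is constant. -/
theorem aux_const {n : ℕ} {K : Type*} [Field K] [CharZero K] (p : MvPolynomial (Fin n) K)
    (hp : ∀ i, pderiv i p = 0) : ∃ c : K, p = C c := by
  refine ⟨coeff 0 p, ?_⟩
  ext m
  rw [coeff_C]
  split_ifs with hm
  · rw [hm]
  · obtain ⟨i, hi⟩ : ∃ i, m i ≠ 0 := by
      by_contra! hc
      exact hm (by ext i; simp [hc i])
    have h1 := congrArg (coeff (m - Finsupp.single i 1)) (hp i)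
    rw [coeff_pderiv] at h1
    have h2 : m - Finsupp.single i 1 + Finsupp.single i 1 = m := by
      apply tsub_add_cancel_of_le
      rw [Finsupp.single_le_iff]
      omega
    rw [h2, coeff_zero] at h1
    rcases mul_eq_zero.1 h1 with h3 | h3
    · exact h3
    · exact absurd h3 (Nat.cast_add_one_ne_zero _)

/-- A derivation commuting with all partial derivatives has constant coefficients. -/
theorem aux_comm {n : ℕ} {K : Type*} [Field K] [CharZero K]
    (φ : Derivation K (MvPolynomial (Fin n) K) (MvPolynomial (Fin n) K))
    (hφ : ∀ i : Fin n, ⁅(pderiv i : Derivation K (MvPolynomial (Fin n) K) _), φ⁆ = 0) (j : Fin n) :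
    ∃ c : K, φ (X j) = C c := by
  apply aux_const
  intro i
  have h1 := congrArg (fun D => D (X j)) (hφ i)
  simp only [Derivation.commutator_apply, Derivation.zero_apply] at h1
  have h2 : φ (pderiv i (X j)) = 0 := by
    rw [pderiv_X]
    rcases eq_or_ne j i with rfl | hne
    · simp
    · simp [Pi.single_eq_of_ne hne]
  rw [h2, sub_zero] at h1
  exact h1

/-- The Euler derivation acts on homogeneous polynomials by the degree. -/
theorem aux_euler {n : ℕ} {K : Type*} [Field K] (p : MvPolynomial (Fin n) K) (d : ℕ)
    (hp : p.IsHomogeneous d) :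
    mkDerivation K (X : Fin n → MvPolynomial (Fin n) K) p = (d : K) • p := by
  have h1 : mkDerivation K (X : Fin n → MvPolynomial (Fin n) K) =
      ∑ i : Fin n, (X i : MvPolynomial (Fin n) K) • pderiv i := by
    apply derivation_ext
    intro j
    rw [← Derivation.coeFnAddMonoidHom_apply (∑ i, _), map_sum]
    simp [mkDerivation_X, pderiv_X, Pi.single_apply]
  rw [h1, ← Derivation.coeFnAddMonoidHom_apply, map_sum]
  simpa [Nat.cast_smul_eq_nsmul] using hp.sum_X_mul_pderiv

theorem aux_unique {n : ℕ} {K : Type*} [Field K] [CharZero K]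
    (σ ρ : Derivation K (MvPolynomial (Fin n) K) (MvPolynomial (Fin n) K) →ₗ⁅K⁆
         Derivation K (MvPolynomial (Fin n) K) (MvPolynomial (Fin n) K))
    (hσ : ∀ i : Fin n, σ (pderiv i) = pderiv i) (hρ : ∀ i : Fin n, ρ (pderiv i) = pderiv i)
    (l : Fin n → K)
    (hE : ∀ i, σ (mkDerivation K X) (X i) = X i + C (l i))
    (hE' : σ (mkDerivation K X) = ρ (mkDerivation K X)) (δ) : σ δ = ρ δ := by
  have key : ∀ (d : ℕ) (p : MvPolynomial (Fin n) K), p.IsHomogeneous d → ∀ j : Fin n,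
      σ (mkDerivation K (Pi.single j p)) = ρ (mkDerivation K (Pi.single j p)) := by
    intro d
    induction d with
    | zero =>
      intro p hp j
      obtain ⟨c, rfl⟩ : ∃ c, p = C c :=
        ⟨_, totalDegree_eq_zero_iff_eq_C.1 (Nat.le_zero.1 hp.totalDegree_le)⟩
      have : mkDerivation K (Pi.single j (C c : MvPolynomial (Fin n) K)) = c • pderiv j := by
        apply derivation_ext
        intro k
        rcases eq_or_ne k j with rfl | hne
        · simp [mkDerivation_X, pderiv_X, smul_eq_C_mul]
        · simp [mkDerivation_X, pderiv_X, Pi.single_eq_of_ne hne]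
      rw [this, map_smul, map_smul, hσ, hρ]
    | succ d ih =>
      intro p hp j
      set M := mkDerivation K (Pi.single j p) with hM
      have hbr : ∀ i : Fin n, ⁅(pderiv i : Derivation K (MvPolynomial (Fin n) K) _), M⁆
          = mkDerivation K (Pi.single j (pderiv i p)) := by
        intro i
        apply derivation_ext
        intro k
        have h2 : M (pderiv i (X k)) = 0 := by
          rw [pderiv_X]
          rcases eq_or_ne k i with rfl | hne
          · simp
          · simp [Pi.single_eq_of_ne hne]
        rw [Derivation.commutator_apply, h2, hM, mkDerivation_X, mkDerivation_X]
        rcases eq_or_ne k j with rfl | hne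
        · simp
        · simp [Pi.single_eq_of_ne hne]
      have hcomm : ∀ i : Fin n,
          ⁅(pderiv i : Derivation K (MvPolynomial (Fin n) K) _), σ M - ρ M⁆ = 0 := by
        intro i
        have h1 : ⁅(pderiv i : Derivation K (MvPolynomial (Fin n) K) _), σ M⁆
            = σ ⁅(pderiv i : Derivation K (MvPolynomial (Fin n) K) _), M⁆ := by
          rw [LieHom.map_lie, hσ]
        have h2 : ⁅(pderiv i : Derivation K (MvPolynomial (Fin n) K) _), ρ M⁆
            = ρ ⁅(pderiv i : Derivation K (MvPolynomial (Fin n) K) _), M⁆ := by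
          rw [LieHom.map_lie, hρ]
        rw [aux_lie_sub, h1, h2, hbr, ih _ (by simpa using hp.pderiv), sub_self]
      have hEM : ⁅mkDerivation K (X : Fin n → MvPolynomial (Fin n) K), M⁆ = (d : K) • M := by
        apply derivation_ext
        intro k
        rw [Derivation.commutator_apply, mkDerivation_X, Derivation.smul_apply, hM, mkDerivation_X]
        rcases eq_or_ne k j with rfl | hne
        · rw [mkDerivation_X, Pi.single_eq_same, aux_euler p _ hp]
          push_cast
          rw [add_smul, one_smul, add_sub_cancel_right]
        · simp [Pi.single_eq_of_ne hne]
      have hbrk : ⁅σ (mkDerivation K X), σ M - ρ M⁆ = (d : K) • (σ M - ρ M) := by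
        rw [aux_lie_sub, ← LieHom.map_lie, hE', ← LieHom.map_lie, hEM, map_smul, map_smul, smul_sub]
      apply sub_eq_zero.1
      apply derivation_ext
      intro k
      obtain ⟨c, hc⟩ := aux_comm _ hcomm k
      have h3 := congrArg (fun D => D (X k)) hbrk
      beta_reduce at h3
      rw [Derivation.commutator_apply, hE, map_add, derivation_C, Derivation.smul_apply, hc,
        derivation_C, add_zero, zero_sub] at h3
      rw [hc, Derivation.zero_apply]
      have h4 : ((d : K) + 1) • (C c : MvPolynomial (Fin n) K) = 0 := by
        rw [add_smul, ← h3, one_smul, neg_add_cancel]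
      exact (smul_eq_zero.1 h4).resolve_left (Nat.cast_add_one_ne_zero d)
  have hlin : σ.toLinearMap ∘ₗ (mkDerivationEquiv (σ := Fin n) (A := MvPolynomial (Fin n) K) K).toLinearMap
      = ρ.toLinearMap ∘ₗ (mkDerivationEquiv K).toLinearMap := by
    apply LinearMap.pi_ext'
    intro j
    apply MvPolynomial.linearMap_ext
    intro m
    apply LinearMap.ext
    intro c
    exact key _ (monomial m c) (isHomogeneous_monomial c rfl) j
  have := LinearMap.congr_fun hlin ((mkDerivationEquiv K).symm δ)
  simpa using this

/-- Conjugation of derivations by an algebra automorphism. -/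
noncomputable def auxConj {K A : Type*} [Field K] [CommRing A] [Algebra K A] (s : A ≃ₐ[K] A) :
    Derivation K A A →ₗ⁅K⁆ Derivation K A A where
  toFun δ := Derivation.mk' (s.toLinearMap ∘ₗ (δ : A →ₗ[K] A) ∘ₗ s.symm.toLinearMap)
    (by intro a b; simp)
  map_add' a b := by
    ext x
    exact map_add s _ _
  map_smul' a b := by
    ext x
    exact map_smul s _ _
  map_lie' := by
    intro a b
    ext x
    change s (a (b (s.symm x)) - b (a (s.symm x)))
      = s (a (s.symm (s (b (s.symm x))))) - s (b (s.symm (s (a (s.symm x)))))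
    simp

theorem auxConj_apply {K A : Type*} [Field K] [CommRing A] [Algebra K A] (s : A ≃ₐ[K] A)
    (δ : Derivation K A A) (p : A) : auxConj s δ p = s (δ (s.symm p)) := rfl

/-- Every Lie algebra automorphism σ of D_n = Der_K(P_n) fixing all ∂_i is given by
conjugation by a shift automorphism s_λ : x_i ↦ x_i + λ_i of P_n. -/
theorem lie_automorphism_fixing_partials_is_shift (n : ℕ) (K : Type*) [Field K] [CharZero K]
    (σ : Derivation K (MvPolynomial (Fin n) K) (MvPolynomial (Fin n) K) ≃ₗ⁅K⁆
         Derivation K (MvPolynomial (Fin n) K) (MvPolynomial (Fin n) K))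
    (h : ∀ i : Fin n, σ (pderiv i) = pderiv i) :
    ∃ (l : Fin n → K) (s : MvPolynomial (Fin n) K ≃ₐ[K] MvPolynomial (Fin n) K),
      (∀ i : Fin n, s (X i) = X i + C (l i)) ∧
      (∀ (δ : Derivation K (MvPolynomial (Fin n) K) (MvPolynomial (Fin n) K))
        (p : MvPolynomial (Fin n) K), (σ δ) p = s (δ (s.symm p))) := by
  have hE : ∀ i : Fin n, ⁅(pderiv i : Derivation K (MvPolynomial (Fin n) K) _),
      mkDerivation K (X : Fin n → MvPolynomial (Fin n) K)⁆ = pderiv i := by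
    intro i
    apply derivation_ext
    intro k
    rw [Derivation.commutator_apply, mkDerivation_X, pderiv_X]
    rcases eq_or_ne k i with rfl | hne
    · simp
    · simp [Pi.single_eq_of_ne hne]
  have hcomm : ∀ i : Fin n, ⁅(pderiv i : Derivation K (MvPolynomial (Fin n) K) _),
      σ (mkDerivation K X) - mkDerivation K X⁆ = 0 := by
    intro i
    have h1 : ⁅(pderiv i : Derivation K (MvPolynomial (Fin n) K) _), σ (mkDerivation K X)⁆
        = σ ⁅(pderiv i : Derivation K (MvPolynomial (Fin n) K) _), mkDerivation K X⁆ := by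
      rw [LieEquiv.map_lie, h]
    rw [aux_lie_sub, h1, hE, h, sub_self]
  choose l hl using aux_comm _ hcomm
  have hl' : ∀ i, σ (mkDerivation K X) (X i) = X i + C (l i) := by
    intro i
    have := hl i
    rw [Derivation.sub_apply, mkDerivation_X, sub_eq_iff_eq_add] at this
    rw [this, add_comm]
  let s : MvPolynomial (Fin n) K ≃ₐ[K] MvPolynomial (Fin n) K :=
    AlgEquiv.ofAlgHom (aeval fun i => X i + C (l i)) (aeval fun i => X i - C (l i))
      (by apply algHom_ext; intro i; simp [algebraMap_eq]) (by apply algHom_ext; intro i; simp [algebraMap_eq])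
  have hs : ∀ i, s (X i) = X i + C (l i) := fun i => aeval_X _ i
  have hs' : ∀ i, s.symm (X i) = X i - C (l i) := fun i => aeval_X _ i
  refine ⟨l, s, hs, fun δ p => ?_⟩
  rw [← auxConj_apply]
  refine congrArg (fun D => D p) (aux_unique σ.toLieHom (auxConj s) h ?_ l hl' ?_ δ)
  · intro i
    apply derivation_ext
    intro k
    rw [auxConj_apply, hs', map_sub, derivation_C, sub_zero, pderiv_X]
    rcases eq_or_ne k i with rfl | hne
    · simp
    · simp [Pi.single_eq_of_ne hne]
  · apply derivation_ext
    intro k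
    rw [auxConj_apply, hs', map_sub, derivation_C, sub_zero, mkDerivation_X, hs]
    exact hl' k
end

section
/- If σ is a Lie algebra automorphism of D_n = Der_K(P_n), then the derivations ∂_i' := σ(∂_i), i = 1,...,n, are pairwise commuting, locally nilpotent derivations of the polynomial algebra P_n. -/
open MvPolynomial

namespace PartialsAux

variable {n : ℕ} {K : Type*} [Field K]

theorem pderiv_iter_monomial (i : Fin n) (m : ℕ) : ∀ (s : Fin n →₀ ℕ) (a : K), s i < m →
    (⇑(pderiv (R := K) i))^[m] (monomial s a) = 0 := by
  induction m with
  | zero => intro s a h; omega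
  | succ m ih =>
    intro s a h
    rw [Function.iterate_succ_apply, pderiv_monomial]
    by_cases h0 : s i = 0
    · simp [h0]
    · apply ih
      simp
      omega

theorem iter_zero_of_le (d : Derivation K (MvPolynomial (Fin n) K) (MvPolynomial (Fin n) K))
    (p : MvPolynomial (Fin n) K) {a b : ℕ} (h : a ≤ b) (ha : (⇑d)^[a] p = 0) :
    (⇑d)^[b] p = 0 := by
  obtain ⟨c, rfl⟩ := Nat.exists_eq_add_of_le' h
  rw [Function.iterate_add_apply, ha, iterate_map_zero]

theorem pderiv_nil (i : Fin n) (p : MvPolynomial (Fin n) K) :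
    ∃ m : ℕ, (⇑(pderiv (R := K) i))^[m] p = 0 := by
  induction p using MvPolynomial.induction_on' with
  | monomial s a => exact ⟨s i + 1, pderiv_iter_monomial i _ s a (Nat.lt_succ_self _)⟩
  | add p q hp hq =>
    obtain ⟨a, ha⟩ := hp
    obtain ⟨b, hb⟩ := hq
    refine ⟨max a b, ?_⟩
    rw [iterate_map_add, iter_zero_of_le _ _ (le_max_left a b) ha,
      iter_zero_of_le _ _ (le_max_right a b) hb, add_zero]

theorem ad_iter_X (i j : Fin n) (m : ℕ) :
    ∀ d : Derivation K (MvPolynomial (Fin n) K) (MvPolynomial (Fin n) K),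
    ((fun e => ⁅pderiv (R := K) i, e⁆)^[m] d) (X j) = (⇑(pderiv (R := K) i))^[m] (d (X j)) := by
  induction m with
  | zero => intro d; rfl
  | succ m ih =>
    intro d
    rw [Function.iterate_succ_apply, Function.iterate_succ_apply, ih, Derivation.commutator_apply]
    congr 1
    rw [pderiv_X]
    by_cases h : i = j
    · subst h; simp
    · simp [Pi.single_apply, Ne.symm h, h]

theorem ad_nil (i : Fin n) (d : Derivation K (MvPolynomial (Fin n) K) (MvPolynomial (Fin n) K)) :
    ∃ m : ℕ, (fun e => ⁅pderiv (R := K) i, e⁆)^[m] d = 0 := by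
  choose f hf using fun j : Fin n => pderiv_nil i (d (X j))
  refine ⟨∑ j, f j, ?_⟩
  apply MvPolynomial.derivation_ext
  intro j
  rw [ad_iter_X]
  exact iter_zero_of_le _ _
    (Finset.single_le_sum (f := f) (fun _ _ => Nat.zero_le _) (Finset.mem_univ j)) (hf j)

theorem ad_iter_smul (d : Derivation K (MvPolynomial (Fin n) K) (MvPolynomial (Fin n) K)) (m : ℕ) :
    ∀ p : MvPolynomial (Fin n) K, (fun e => ⁅d, e⁆)^[m] (p • d) = ((⇑d)^[m] p) • d := by
  induction m with
  | zero => intro p; rfl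
  | succ m ih =>
    intro p
    rw [Function.iterate_succ_apply, Function.iterate_succ_apply, ← ih]
    congr 1
    ext1 j
    simp [Derivation.commutator_apply]
    ring

end PartialsAux

/-- If σ is a Lie algebra automorphism of D_n = Der_K(P_n), then the derivations
∂_i' = σ(∂_i) are pairwise commuting locally nilpotent derivations of P_n. -/
theorem image_of_partials_commuting_locally_nilpotent (n : ℕ) (K : Type*) [Field K] [CharZero K]
    (σ : Derivation K (MvPolynomial (Fin n) K) (MvPolynomial (Fin n) K) ≃ₗ⁅K⁆
         Derivation K (MvPolynomial (Fin n) K) (MvPolynomial (Fin n) K)) :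
    (∀ i j : Fin n, ⁅σ (pderiv i), σ (pderiv j)⁆ = 0) ∧
    (∀ (i : Fin n) (p : MvPolynomial (Fin n) K), ∃ m : ℕ, (⇑(σ (pderiv i)))^[m] p = 0) := by
  have hbr : ∀ i j : Fin n, ⁅pderiv (R := K) i, pderiv (R := K) j⁆ = 0 := by
    intro i j
    apply MvPolynomial.derivation_ext
    intro k
    rw [Derivation.commutator_apply, pderiv_X, pderiv_X]
    by_cases h1 : i = k <;> by_cases h2 : j = k <;> simp [Pi.single_apply, h1, h2, eq_comm]
  refine ⟨fun i j => by rw [← LieEquiv.map_lie, hbr, map_zero], fun i p => ?_⟩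
  by_cases h0 : σ (pderiv i) = 0
  · exact ⟨1, by simp [h0]⟩
  obtain ⟨q, hq⟩ := σ.surjective (p • σ (pderiv i))
  change σ q = _ at hq
  obtain ⟨m, hm⟩ := PartialsAux.ad_nil i q
  refine ⟨m, ?_⟩
  have hs : Function.Semiconj σ (fun e => ⁅pderiv (R := K) i, e⁆)
      (fun e => ⁅σ (pderiv i), e⁆) := fun e => LieEquiv.map_lie σ _ _
  have h := (hs.iterate_right m) q
  rw [hm, hq, PartialsAux.ad_iter_smul, map_zero] at h
  by_contra hne
  apply h0
  ext1 j
  have h2 := congrArg (fun D => D (X j)) h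
  simp only [Derivation.smul_apply, smul_eq_mul, Derivation.zero_apply] at h2 ⊢
  exact (mul_eq_zero.mp h2.symm).resolve_left hne
end

section
/- If σ is a Lie algebra automorphism of D_n = Der_K(P_n) and ∂_i' := σ(∂_i), then the intersection of the kernels ∩_{i=1}^n ker_{P_n}(∂_i') equals K. -/
open MvPolynomial

/-- In characteristic zero, a polynomial killed by all partial derivatives is constant. -/
theorem eq_C_of_pderiv_eq_zero {n : ℕ} {K : Type*} [Field K] [CharZero K]
    (p : MvPolynomial (Fin n) K) (h : ∀ i, pderiv i p = 0) : p = C (p.coeff 0) := by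
  classical
  ext m
  rw [coeff_C]
  split_ifs with hm
  · rw [hm]
  · have : ∃ i, m i ≠ 0 := by
      by_contra! hc
      exact hm (Finsupp.ext fun i => (hc i).symm)
    obtain ⟨i, hi⟩ := this
    have h1 := coeff_pderiv (i := i) p (m - Finsupp.single i 1)
    have h2 : m - Finsupp.single i 1 + Finsupp.single i 1 = m := by
      apply tsub_add_cancel_of_le
      rw [Finsupp.single_le_iff]
      omega
    rw [h i, coeff_zero, h2] at h1
    exact (mul_eq_zero.mp h1.symm).resolve_right (Nat.cast_add_one_ne_zero _)

/-- The centralizer of the partial derivatives is their linear span. -/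
theorem eq_sum_of_comm {n : ℕ} {K : Type*} [Field K] [CharZero K]
    (D : Derivation K (MvPolynomial (Fin n) K) (MvPolynomial (Fin n) K))
    (h : ∀ i, ⁅(pderiv i : Derivation K (MvPolynomial (Fin n) K) (MvPolynomial (Fin n) K)), D⁆ = 0) :
    ∃ c : Fin n → K, D = ∑ i, c i • pderiv i := by
  classical
  refine ⟨fun i => (D (X i)).coeff 0, derivation_ext fun j => ?_⟩
  have hj : D (X j) = C ((D (X j)).coeff 0) := by
    apply eq_C_of_pderiv_eq_zero
    intro i
    have h1 := congrArg (fun E => E (X j)) (h i)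
    simp only [Derivation.commutator_apply, Derivation.zero_apply, pderiv_X] at h1
    have h2 : D (Pi.single (M := fun _ => MvPolynomial (Fin n) K) i 1 j) = 0 := by
      by_cases hij : j = i
      · subst hij; simp
      · simp [Pi.single_eq_of_ne hij]
    rwa [h2, sub_zero] at h1
  have hs : (∑ i, (D (X i)).coeff 0 • (pderiv i :
      Derivation K (MvPolynomial (Fin n) K) (MvPolynomial (Fin n) K))) (X j)
      = ∑ i, (D (X i)).coeff 0 • pderiv i (X j) := by
    rw [← Derivation.coeFnAddMonoidHom_apply, map_sum, Finset.sum_apply]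
    rfl
  rw [hs, Finset.sum_eq_single j]
  · rw [pderiv_X_self, smul_eq_C_mul, mul_one]; exact hj
  · intro i _ hij
    rw [pderiv_X_of_ne hij.symm, smul_zero]
  · simp

/-- If σ is a Lie algebra automorphism of D_n = Der_K(P_n) and ∂_i' = σ(∂_i), then
∩_{i=1}^n ker_{P_n}(∂_i') = K. -/
theorem kernels_of_image_partials (n : ℕ) (K : Type*) [Field K] [CharZero K]
    (σ : Derivation K (MvPolynomial (Fin n) K) (MvPolynomial (Fin n) K) ≃ₗ⁅K⁆
         Derivation K (MvPolynomial (Fin n) K) (MvPolynomial (Fin n) K))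
    (p : MvPolynomial (Fin n) K) :
    (∀ i : Fin n, σ (pderiv i) p = 0) ↔ ∃ c : K, p = C c := by
  classical
  constructor
  swap
  · rintro ⟨c, rfl⟩ i
    exact (σ (pderiv i)).map_algebraMap c
  intro hp
  by_cases hp0 : p = 0
  · exact ⟨0, by simp [hp0]⟩
  rcases n with _ | n
  · exact ⟨_, eq_C_of_isEmpty p⟩
  refine ⟨p.coeff 0, totalDegree_eq_zero_iff_eq_C.mp ?_⟩
  -- multiplication by p preserves the span of the images
  have key : ∀ i, ∃ c : Fin (n+1) → K, p • σ (pderiv i) = ∑ k, c k • σ (pderiv k) := by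
    intro i
    have hc : ∀ k, ⁅(pderiv k : Derivation K (MvPolynomial (Fin (n+1)) K)
        (MvPolynomial (Fin (n+1)) K)), (pderiv i : Derivation K (MvPolynomial (Fin (n+1)) K)
        (MvPolynomial (Fin (n+1)) K))⁆ = 0 := by
      intro k
      refine derivation_ext fun j => ?_
      rw [Derivation.commutator_apply, pderiv_X, pderiv_X, Derivation.zero_apply]
      have : ∀ a b : Fin (n+1), pderiv a (Pi.single (M := fun _ => MvPolynomial (Fin (n+1)) K) b 1 j) = 0 := by
        intro a b
        by_cases hij : j = b
        · subst hij; simp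
        · simp [Pi.single_eq_of_ne hij]
      rw [this, this, sub_zero]
    obtain ⟨c, hc⟩ := eq_sum_of_comm (σ.symm (p • σ (pderiv i))) (by
      intro k
      apply σ.injective
      change σ _ = σ 0
      rw [LieEquiv.map_lie, LieEquiv.apply_symm_apply, map_zero]
      have h1 : ⁅σ (pderiv k), σ (pderiv i)⁆ = 0 := by
        rw [← LieEquiv.map_lie, hc, map_zero]
      ext1 f
      have h2 := congrArg (fun E => E (X f)) h1
      simp only [Derivation.commutator_apply, Derivation.zero_apply] at h2
      simp only [Derivation.commutator_apply, Derivation.zero_apply, Derivation.smul_apply,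
        smul_eq_mul, Derivation.leibniz, hp k, mul_zero, add_zero]
      rw [← mul_sub, h2, mul_zero])
    refine ⟨c, ?_⟩
    have := congrArg σ hc
    rw [LieEquiv.apply_symm_apply] at this
    rw [this, map_sum]
    simp only [map_smul]
  have hne : σ (pderiv 0) ≠ 0 := by
    intro h
    have h0 : (pderiv 0 : Derivation K (MvPolynomial (Fin (n+1)) K)
        (MvPolynomial (Fin (n+1)) K)) = 0 := σ.injective (h.trans (map_zero σ).symm)
    have h1 := congrArg (fun E => E (X 0)) h0
    simp at h1
  obtain ⟨j, hj⟩ : ∃ j, σ (pderiv 0) (X j) ≠ 0 := by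
    by_contra! hcon
    exact hne (derivation_ext fun j => by simpa using hcon j)
  obtain ⟨i, hi, hmax⟩ := Finset.exists_max_image
    (Finset.univ.filter fun i => σ (pderiv i) (X j) ≠ 0)
    (fun i => (σ (pderiv i) (X j)).totalDegree) ⟨0, by simpa using hj⟩
  have hi' : σ (pderiv i) (X j) ≠ 0 := by simpa using hi
  obtain ⟨c, hc⟩ := key i
  have hE := congrArg (fun E => E (X j)) hc
  have hs : (∑ k, c k • σ (pderiv k)) (X j) = ∑ k, c k • σ (pderiv k) (X j) := by
    rw [← Derivation.coeFnAddMonoidHom_apply, map_sum, Finset.sum_apply]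
    rfl
  simp only [hs, Derivation.smul_apply, smul_eq_mul] at hE
  have hle : (p * σ (pderiv i) (X j)).totalDegree ≤ (σ (pderiv i) (X j)).totalDegree := by
    rw [hE]
    apply totalDegree_finsetSum_le
    intro k _
    refine (totalDegree_smul_le _ _).trans ?_
    by_cases hk : σ (pderiv k) (X j) = 0
    · simp [hk]
    · exact hmax k (by simpa using hk)
  rw [totalDegree_mul_of_isDomain hp0 hi'] at hle
  omega
end
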